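/- (Single-step error decay bound.) Let P ∈ ℝ^{m₁×m₁} and Q ∈ ℝ^{m₂×m₂} be symmetric idempotent, σ² > 0, η² > 0, γ² = η²/σ². Let Ω be a sequence of N pairwise distinct indices, (i,j) ∉ Ω, and (k,l) an arbitrary index. Suppose v_Ω(i,j) > 0 and v_Ω(k,l) > 0, and define the conditional correlation ρ² := c_Ω((i,j),(k,l))² / ( v_Ω(i,j) · v_Ω(k,l) ). Then v_{Ω∪(i,j)}(k,l) ≥ v_Ω(k,l) · ( 1 − ρ² / (1 + γ²) ). -/

import Mathlib

open Matrix

noncomputable section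

/-- The design covariance matrix `R_N(Ω)` with entries `P_{i_n,i_{n'}} Q_{j_n,j_{n'}}`. -/
def designR {m₁ m₂ N : ℕ} (P : Matrix (Fin m₁) (Fin m₁) ℝ) (Q : Matrix (Fin m₂) (Fin m₂) ℝ)
    (Ω : Fin N → Fin m₁ × Fin m₂) : Matrix (Fin N) (Fin N) ℝ :=
  Matrix.of fun n n' => P (Ω n).1 (Ω n').1 * Q (Ω n).2 (Ω n').2

/-- The cross-coherence vector `ν_{k,l}(Ω)` with `n`-th entry `P_{k,i_n} Q_{l,j_n}`. -/
def nuVec {m₁ m₂ N : ℕ} (P : Matrix (Fin m₁) (Fin m₁) ℝ) (Q : Matrix (Fin m₂) (Fin m₂) ℝ)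
    (Ω : Fin N → Fin m₁ × Fin m₂) (k : Fin m₁) (l : Fin m₂) : Fin N → ℝ :=
  fun n => P k (Ω n).1 * Q l (Ω n).2

/-- Conditional variance formula `v_Ω(k,l)`. -/
def condVar {m₁ m₂ N : ℕ} (σ2 γ2 : ℝ) (P : Matrix (Fin m₁) (Fin m₁) ℝ)
    (Q : Matrix (Fin m₂) (Fin m₂) ℝ) (Ω : Fin N → Fin m₁ × Fin m₂)
    (k : Fin m₁) (l : Fin m₂) : ℝ :=
  σ2 * (P k k * Q l l -
    nuVec P Q Ω k l ⬝ᵥ ((designR P Q Ω + γ2 • (1 : Matrix (Fin N) (Fin N) ℝ))⁻¹ *ᵥ nuVec P Q Ω k l))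

/-- Conditional covariance formula `c_Ω((i,j),(k,l))`. -/
def condCov {m₁ m₂ N : ℕ} (σ2 γ2 : ℝ) (P : Matrix (Fin m₁) (Fin m₁) ℝ)
    (Q : Matrix (Fin m₂) (Fin m₂) ℝ) (Ω : Fin N → Fin m₁ × Fin m₂)
    (i k : Fin m₁) (j l : Fin m₂) : ℝ :=
  σ2 * (P i k * Q j l -
    nuVec P Q Ω i j ⬝ᵥ ((designR P Q Ω + γ2 • (1 : Matrix (Fin N) (Fin N) ℝ))⁻¹ *ᵥ nuVec P Q Ω k l))

/-- Observational entropy `H(Ω) = det(σ² R_N(Ω) + η² I)`. -/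
def obsEntropy {m₁ m₂ N : ℕ} (σ2 η2 : ℝ) (P : Matrix (Fin m₁) (Fin m₁) ℝ)
    (Q : Matrix (Fin m₂) (Fin m₂) ℝ) (Ω : Fin N → Fin m₁ × Fin m₂) : ℝ :=
  (σ2 • designR P Q Ω + η2 • (1 : Matrix (Fin N) (Fin N) ℝ)).det

/-- Sequential criterion `H((i,j)|Ω)`. -/
def seqCrit {m₁ m₂ N : ℕ} (γ2 : ℝ) (P : Matrix (Fin m₁) (Fin m₁) ℝ)
    (Q : Matrix (Fin m₂) (Fin m₂) ℝ) (Ω : Fin N → Fin m₁ × Fin m₂)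
    (i : Fin m₁) (j : Fin m₂) : ℝ :=
  P i i * Q j j -
    nuVec P Q Ω i j ⬝ᵥ ((designR P Q Ω + γ2 • (1 : Matrix (Fin N) (Fin N) ℝ))⁻¹ *ᵥ nuVec P Q Ω i j)

theorem Matrix.IsSymm.posSemidef_of_mul_self {n : Type*} [Fintype n] {P : Matrix n n ℝ}
    (hsymm : P.IsSymm) (hidem : P * P = P) : P.PosSemidef := by
  have h := Matrix.posSemidef_conjTranspose_mul_self P
  rwa [Matrix.conjTranspose_eq_transpose_of_trivial, hsymm.eq, hidem] at h

theorem Matrix.IsSymm.apply_self_le_one_of_mul_self {n : Type*} [Fintype n] {P : Matrix n n ℝ}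
    (hsymm : P.IsSymm) (hidem : P * P = P) (i : n) : P i i ≤ 1 := by
  have hsum : P i i = ∑ x, P i x ^ 2 := by
    conv_lhs => rw [← hidem, Matrix.mul_apply]
    refine Finset.sum_congr rfl fun x _ => ?_
    rw [← Matrix.transpose_apply P i x, hsymm.eq, sq]
  have hle : P i i ^ 2 ≤ ∑ x, P i x ^ 2 :=
    Finset.single_le_sum (f := fun x => P i x ^ 2) (fun x _ => sq_nonneg _) (Finset.mem_univ i)
  nlinarith

theorem designR_posSemidef {m₁ m₂ N : ℕ} {P : Matrix (Fin m₁) (Fin m₁) ℝ}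
    {Q : Matrix (Fin m₂) (Fin m₂) ℝ} (hP : P.PosSemidef) (hQ : Q.PosSemidef)
    (Ω : Fin N → Fin m₁ × Fin m₂) : (designR P Q Ω).PosSemidef :=
  (hP.kronecker hQ).submatrix Ω

theorem designR_add_smul_one_posDef {m₁ m₂ N : ℕ} {P : Matrix (Fin m₁) (Fin m₁) ℝ}
    {Q : Matrix (Fin m₂) (Fin m₂) ℝ} (hP : P.PosSemidef) (hQ : Q.PosSemidef)
    (Ω : Fin N → Fin m₁ × Fin m₂) {c : ℝ} (hc : 0 < c) :
    (designR P Q Ω + c • (1 : Matrix (Fin N) (Fin N) ℝ)).PosDef :=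
  Matrix.PosDef.posSemidef_add (designR_posSemidef hP hQ Ω) (Matrix.PosDef.one.smul hc)

/-- The inverse quadratic form of a bordered symmetric matrix, through its Schur complement. -/
theorem dotProduct_inv_mulVec_of_bordered {N : ℕ} {A : Matrix (Fin N) (Fin N) ℝ}
    {B : Matrix (Fin (N + 1)) (Fin (N + 1)) ℝ} {b : Fin N → ℝ} {d : ℝ}
    (hA : IsUnit A.det) (hB : IsUnit B.det) (hsymm : Aᵀ = A)
    (hBA : ∀ x y : Fin N, B x.castSucc y.castSucc = A x y)
    (hBcol : ∀ x : Fin N, B x.castSucc (Fin.last N) = b x)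
    (hBrow : ∀ y : Fin N, B (Fin.last N) y.castSucc = b y)
    (hBlast : B (Fin.last N) (Fin.last N) = d)
    (hs : d - b ⬝ᵥ (A⁻¹ *ᵥ b) ≠ 0) {u : Fin N → ℝ} {v : Fin (N + 1) → ℝ}
    (hv : ∀ x : Fin N, v x.castSucc = u x) :
    v ⬝ᵥ (B⁻¹ *ᵥ v) = u ⬝ᵥ (A⁻¹ *ᵥ u) +
      (v (Fin.last N) - b ⬝ᵥ (A⁻¹ *ᵥ u)) ^ 2 / (d - b ⬝ᵥ (A⁻¹ *ᵥ b)) := by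
  set s := d - b ⬝ᵥ (A⁻¹ *ᵥ b) with hs_def
  set t := (v (Fin.last N) - b ⬝ᵥ (A⁻¹ *ᵥ u)) / s with ht
  set z : Fin N → ℝ := A⁻¹ *ᵥ u - t • (A⁻¹ *ᵥ b) with hz
  have hts : t * s = v (Fin.last N) - b ⬝ᵥ (A⁻¹ *ᵥ u) := div_mul_cancel₀ _ hs
  have hAz : A *ᵥ z = u - t • b := by
    rw [hz, Matrix.mulVec_sub, Matrix.mulVec_smul, Matrix.mulVec_mulVec, Matrix.mulVec_mulVec,
      Matrix.mul_nonsing_inv A hA, Matrix.one_mulVec, Matrix.one_mulVec]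
  have hbz : b ⬝ᵥ z = b ⬝ᵥ (A⁻¹ *ᵥ u) - t * (b ⬝ᵥ (A⁻¹ *ᵥ b)) := by
    rw [hz, dotProduct_sub, dotProduct_smul, smul_eq_mul]
  have huz : u ⬝ᵥ z = u ⬝ᵥ (A⁻¹ *ᵥ u) - t * (b ⬝ᵥ (A⁻¹ *ᵥ u)) := by
    have hub : u ⬝ᵥ (A⁻¹ *ᵥ b) = b ⬝ᵥ (A⁻¹ *ᵥ u) := by
      rw [Matrix.dotProduct_mulVec, ← Matrix.mulVec_transpose, Matrix.transpose_nonsing_inv,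
        hsymm, dotProduct_comm]
    rw [hz, dotProduct_sub, dotProduct_smul, smul_eq_mul, hub]
  have hsol : B *ᵥ Fin.snoc (α := fun _ => ℝ) z t = v := by
    funext x
    refine Fin.lastCases ?_ (fun y => ?_) x
    · have : b ⬝ᵥ z + d * t = v (Fin.last N) := by
        rw [hbz]; linear_combination hts - t * hs_def
      simpa [Matrix.mulVec, dotProduct, Fin.sum_univ_castSucc, hBrow, hBlast] using this
    · have h := congrFun hAz y
      simp only [Matrix.mulVec, dotProduct, Pi.sub_apply, Pi.smul_apply, smul_eq_mul] at h
      simp only [Matrix.mulVec, dotProduct, Fin.sum_univ_castSucc, Fin.snoc_castSucc,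
        Fin.snoc_last, hBA, hBcol, hv]
      linear_combination h
  have hinv : B⁻¹ *ᵥ v = Fin.snoc (α := fun _ => ℝ) z t := by
    rw [← hsol, Matrix.mulVec_mulVec, Matrix.nonsing_inv_mul B hB, Matrix.one_mulVec]
  have hdot : v ⬝ᵥ Fin.snoc (α := fun _ => ℝ) z t = u ⬝ᵥ z + v (Fin.last N) * t := by
    simp [dotProduct, Fin.sum_univ_castSucc, hv]
  rw [hinv, hdot, huz, sq, mul_div_assoc, ← ht]
  ring

/-- The rank-one update of the conditional variance after one more observation. -/
theorem condVar_snoc {m₁ m₂ N : ℕ} {P : Matrix (Fin m₁) (Fin m₁) ℝ}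
    {Q : Matrix (Fin m₂) (Fin m₂) ℝ} (hP : P.PosSemidef) (hQ : Q.PosSemidef)
    {σ2 γ2 : ℝ} (hσ2 : 0 < σ2) (hγ2 : 0 < γ2) (Ω : Fin N → Fin m₁ × Fin m₂)
    (i : Fin m₁) (j : Fin m₂) (hv : 0 < condVar σ2 γ2 P Q Ω i j) (k : Fin m₁) (l : Fin m₂) :
    condVar σ2 γ2 P Q (Fin.snoc Ω (i, j)) k l = condVar σ2 γ2 P Q Ω k l -
      condCov σ2 γ2 P Q Ω i k j l ^ 2 / (condVar σ2 γ2 P Q Ω i j + σ2 * γ2) := by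
  have hA := designR_add_smul_one_posDef hP hQ Ω hγ2
  have hB := designR_add_smul_one_posDef hP hQ
    (Fin.snoc (α := fun _ => Fin m₁ × Fin m₂) Ω (i, j)) hγ2
  have hPs (a b) : P a b = P b a := by simpa using (hP.isHermitian.apply a b).symm
  have hQs (a b) : Q a b = Q b a := by simpa using (hQ.isHermitian.apply a b).symm
  have hAs : (designR P Q Ω + γ2 • (1 : Matrix (Fin N) (Fin N) ℝ))ᵀ = designR P Q Ω + γ2 • 1 := by
    simpa [Matrix.IsHermitian, Matrix.conjTranspose_eq_transpose_of_trivial] using hA.isHermitian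
  have hs : 0 < P i i * Q j j + γ2 - nuVec P Q Ω i j ⬝ᵥ
      ((designR P Q Ω + γ2 • (1 : Matrix (Fin N) (Fin N) ℝ))⁻¹ *ᵥ nuVec P Q Ω i j) := by
    have := pos_of_mul_pos_right hv hσ2.le
    linarith
  have key := dotProduct_inv_mulVec_of_bordered (b := nuVec P Q Ω i j)
    (d := P i i * Q j j + γ2) (u := nuVec P Q Ω k l)
    (v := nuVec P Q (Fin.snoc (α := fun _ => Fin m₁ × Fin m₂) Ω (i, j)) k l)
    hA.det_pos.ne'.isUnit hB.det_pos.ne'.isUnit hAs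
    (fun x y => by simp [designR, Matrix.one_apply])
    (fun x => by simp [designR, nuVec, hPs i, hQs j, Fin.castSucc_ne_last])
    (fun y => by simp [designR, nuVec, (Fin.castSucc_ne_last y).symm])
    (by simp [designR]) hs.ne' (fun x => by simp [nuVec])
  have hlast : nuVec P Q (Fin.snoc (α := fun _ => Fin m₁ × Fin m₂) Ω (i, j)) k l (Fin.last N) =
      P i k * Q j l := by simp [nuVec, hPs i k, hQs j l]
  rw [hlast] at key
  unfold condVar condCov
  rw [key]
  rw [show ∀ a b c : ℝ, σ2 * (a - b) + σ2 * c = σ2 * (a + c - b) by intros; ring]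
  field_simp
  ring

theorem condVar_le {m₁ m₂ N : ℕ} {P : Matrix (Fin m₁) (Fin m₁) ℝ}
    {Q : Matrix (Fin m₂) (Fin m₂) ℝ} (hP : P.PosSemidef) (hQ : Q.PosSemidef)
    {σ2 γ2 : ℝ} (hσ2 : 0 < σ2) (hγ2 : 0 < γ2) (Ω : Fin N → Fin m₁ × Fin m₂)
    (i : Fin m₁) (j : Fin m₂) (hPi : P i i ≤ 1) (hQj : Q j j ≤ 1) :
    condVar σ2 γ2 P Q Ω i j ≤ σ2 := by
  have hquad : 0 ≤ nuVec P Q Ω i j ⬝ᵥ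
      ((designR P Q Ω + γ2 • (1 : Matrix (Fin N) (Fin N) ℝ))⁻¹ *ᵥ nuVec P Q Ω i j) := by
    simpa using (designR_add_smul_one_posDef hP hQ Ω hγ2).inv.posSemidef.dotProduct_mulVec_nonneg
      (nuVec P Q Ω i j)
  have hprod : P i i * Q j j ≤ 1 := mul_le_one₀ hPi hQ.diag_nonneg hQj
  unfold condVar
  exact mul_le_of_le_one_right hσ2.le (by linarith)

/-- **Single-step error decay bound.** If `v_Ω(i,j) > 0` and
`v_Ω(k,l) > 0`, with conditional correlation
`ρ² = c_Ω((i,j),(k,l))² / (v_Ω(i,j) v_Ω(k,l))`, then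
`v_{Ω∪(i,j)}(k,l) ≥ v_Ω(k,l) (1 − ρ²/(1+γ²))`. -/
theorem condVar_single_step_lower_bound {m₁ m₂ N : ℕ}
    (P : Matrix (Fin m₁) (Fin m₁) ℝ) (Q : Matrix (Fin m₂) (Fin m₂) ℝ)
    (hPsymm : Pᵀ = P) (hPidem : P * P = P)
    (hQsymm : Qᵀ = Q) (hQidem : Q * Q = Q)
    (σ2 η2 γ2 : ℝ) (hσ2 : 0 < σ2) (hη2 : 0 < η2) (hγ2 : γ2 = η2 / σ2)
    (Ω : Fin N → Fin m₁ × Fin m₂) (hΩ : Function.Injective Ω)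
    (i : Fin m₁) (j : Fin m₂) (hij : ∀ n, Ω n ≠ (i, j))
    (k : Fin m₁) (l : Fin m₂)
    (hvij : 0 < condVar σ2 γ2 P Q Ω i j) (hvkl : 0 < condVar σ2 γ2 P Q Ω k l)
    (ρ2 : ℝ)
    (hρ2 : ρ2 = (condCov σ2 γ2 P Q Ω i k j l) ^ 2 /
      (condVar σ2 γ2 P Q Ω i j * condVar σ2 γ2 P Q Ω k l)) :
    condVar σ2 γ2 P Q (Fin.snoc Ω (i, j)) k l ≥
      condVar σ2 γ2 P Q Ω k l * (1 - ρ2 / (1 + γ2)) := by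
  have hP := Matrix.IsSymm.posSemidef_of_mul_self hPsymm hPidem
  have hQ := Matrix.IsSymm.posSemidef_of_mul_self hQsymm hQidem
  have hγ : 0 < γ2 := hγ2 ▸ div_pos hη2 hσ2
  have hle : condVar σ2 γ2 P Q Ω i j ≤ σ2 := condVar_le hP hQ hσ2 hγ Ω i j
    (Matrix.IsSymm.apply_self_le_one_of_mul_self hPsymm hPidem i)
    (Matrix.IsSymm.apply_self_le_one_of_mul_self hQsymm hQidem j)
  rw [ge_iff_le, condVar_snoc hP hQ hσ2 hγ Ω i j hvij, hρ2]
  have hdecay : condVar σ2 γ2 P Q Ω k l * (1 - condCov σ2 γ2 P Q Ω i k j l ^ 2 /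
      (condVar σ2 γ2 P Q Ω i j * condVar σ2 γ2 P Q Ω k l) / (1 + γ2)) =
      condVar σ2 γ2 P Q Ω k l -
        condCov σ2 γ2 P Q Ω i k j l ^ 2 / (condVar σ2 γ2 P Q Ω i j * (1 + γ2)) := by
    field_simp
  rw [hdecay]
  gcongr
  nlinarith

end
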